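/- (Isolation of the KKT trajectory.) Suppose for some δ > 0 and η > 0 that Λ_m(δ) − (√η/2) δ M_nc(δ) > 0. Then for every t ∈ [0,S], there is no pair z = (x,λ) with x ∈ 𝒳(t) and λ ∈ ℝ^m_+ satisfying the KKT conditions at time t (that is, ∇_x c(x,t) + J_{f,x}(x,t)ᵀ λ ∈ −N_{𝒳(t)}(x) and f(x,t) ∈ N_{ℝ^m_+}(λ)) such that 0 < ‖z − z*(t)‖_η ≤ δ and x ≠ x*(t). -/

import Mathlib

open Set Metric MeasureTheory Filter
open scoped RealInnerProductSpace Topology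

noncomputable section

namespace TVOpt

/-- Euclidean space `ℝ^d`. -/
abbrev E (d : ℕ) := EuclideanSpace ℝ (Fin d)

/-- Normal cone of a (convex) set `C` at a point `x`. -/
def normalCone {d : ℕ} (C : Set (E d)) (x : E d) : Set (E d) :=
  {y | ∀ w ∈ C, ⟪y, w - x⟫ ≤ 0}

/-- The nonnegative orthant `ℝ^m_+`. -/
def orthant (m : ℕ) : Set (E m) := {v | ∀ i, 0 ≤ v i}

/-- `p` is the Euclidean metric projection of `v` onto `C`. -/
def IsProjection {d : ℕ} (C : Set (E d)) (v p : E d) : Prop :=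
  p ∈ C ∧ ∀ w ∈ C, dist v p ≤ dist v w

/-- The `η`-weighted norm `‖(x,λ)‖_η = sqrt(‖x‖² + η⁻¹‖λ‖²)`. -/
def etaNorm {n m : ℕ} (η : ℝ) (z : E n × E m) : ℝ :=
  Real.sqrt (‖z.1‖ ^ 2 + η⁻¹ * ‖z.2‖ ^ 2)

variable {n m : ℕ}

/-- Maximal speed `σ_η` of a trajectory on `[0,S]`. -/
def sigmaEta (S : ℝ) (zstar : ℝ → E n × E m) (η : ℝ) : ℝ :=
  ⨆ p : {q : ℝ × ℝ // q.1 ∈ Icc 0 S ∧ q.2 ∈ Icc 0 S ∧ q.1 ≠ q.2},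
    etaNorm η (zstar p.1.2 - zstar p.1.1) / |p.1.2 - p.1.1|

/-- `M_λ = sup_{t ∈ [0,S]} ‖λ*(t) − λ_prior‖`. -/
def Mlam (S : ℝ) (ls : ℝ → E m) (lamprior : E m) : ℝ :=
  ⨆ t : Icc (0:ℝ) S, ‖ls t.1 - lamprior‖

/-- `M_nc(δ)`:  sup of the second-derivative norm of `f^nc` near the trajectory. -/
def Mnc (S : ℝ) (fnc : E n → ℝ → E m) (xs : ℝ → E n) (δ : ℝ) : ℝ :=
  ⨆ p : {q : ℝ × E n // q.1 ∈ Icc 0 S ∧ ‖q.2‖ ≤ δ},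
    ‖fderiv ℝ (fderiv ℝ (fun x => fnc x p.1.1)) (xs p.1.1 + p.1.2)‖

/-- `M_c(δ)`:  sup of the second-derivative norm of `f^c` near the trajectory. -/
def Mcc (S : ℝ) (fc : E n → ℝ → E m) (xs : ℝ → E n) (δ : ℝ) : ℝ :=
  ⨆ p : {q : ℝ × E n // q.1 ∈ Icc 0 S ∧ ‖q.2‖ ≤ δ},
    ‖fderiv ℝ (fderiv ℝ (fun x => fc x p.1.1)) (xs p.1.1 + p.1.2)‖

/-- `L_f(δ)`: sup of the Jacobian operator norm of `f` near the trajectory. -/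
def Lf (S : ℝ) (f : E n → ℝ → E m) (xs : ℝ → E n) (δ : ℝ) : ℝ :=
  ⨆ p : {q : ℝ × E n // q.1 ∈ Icc 0 S ∧ ‖q.2‖ ≤ δ},
    ‖fderiv ℝ (fun x => f x p.1.1) (xs p.1.1 + p.1.2)‖

/-- `sup_{t∈[0,S]} ‖λ*(t)‖`. -/
def supLam (S : ℝ) (ls : ℝ → E m) : ℝ := ⨆ t : Icc (0:ℝ) S, ‖ls t.1‖

/-- `D(δ,η) = √η L_f(δ) + M_c(δ) sup_t ‖λ*(t)‖`. -/
def Dconst (S : ℝ) (fc fnc : E n → ℝ → E m) (xs : ℝ → E n) (ls : ℝ → E m) (δ η : ℝ) : ℝ :=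
  Real.sqrt η * Lf S (fun x t => fc x t + fnc x t) xs δ + Mcc S fc xs δ * supLam S ls

/-- Hessian of a scalar function, as a linear operator on `ℝ^d`. -/
def hessOp {d : ℕ} (g : E d → ℝ) (x : E d) : E d →L[ℝ] E d :=
  fderiv ℝ (gradient g) x

/-- Nonconvex part of the Lagrangian, `ℒ^nc(x,λ,t) = c(x,t) + λᵀ f^nc(x,t)`. -/
def Lnc (c : E n → ℝ → ℝ) (fnc : E n → ℝ → E m) (x : E n) (lam : E m) (t : ℝ) : ℝ :=
  c x t + ⟪lam, fnc x t⟫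

/-- Averaged Hessian `H̄_{ℒ^nc}(u,t)`. -/
def HbarL (c : E n → ℝ → ℝ) (fnc : E n → ℝ → E m) (xs : ℝ → E n) (ls : ℝ → E m)
    (u : E n) (t : ℝ) : E n →L[ℝ] E n :=
  ∫ θ in (0:ℝ)..1, hessOp (fun x => Lnc c fnc x (ls t) t) (xs t + θ • u)

/-- Averaged Hessian `H̄_{f^c_i}(u,t)`. -/
def Hbarfc (fc : E n → ℝ → E m) (xs : ℝ → E n) (i : Fin m) (u : E n) (t : ℝ) :
    E n →L[ℝ] E n :=
  ∫ θ in (0:ℝ)..1, (2 * (1 - θ)) • hessOp (fun x => fc x t i) (xs t + θ • u)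

/-- `ρ^(P)(δ,α,η,ε)`. -/
def rhoP (S : ℝ) (c : E n → ℝ → ℝ) (fc fnc : E n → ℝ → E m) (xs : ℝ → E n) (ls : ℝ → E m)
    (δ α η ε : ℝ) : ℝ :=
  ⨆ p : {q : ℝ × E n // q.1 ∈ Icc 0 S ∧ ‖q.2‖ ≤ δ},
    ‖((1 : E n →L[ℝ] E n) - α • HbarL c fnc xs ls p.1.2 p.1.1) ^ 2
      - (α * (1 - η * α * ε)) • ∑ i, ls p.1.1 i • Hbarfc fc xs i p.1.2 p.1.1‖

/-- The contraction factor `ρ(δ,α,η,ε)`. -/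
def rho (S : ℝ) (c : E n → ℝ → ℝ) (fc fnc : E n → ℝ → E m) (xs : ℝ → E n) (ls : ℝ → E m)
    (δ α η ε : ℝ) : ℝ :=
  Real.sqrt (max (rhoP S c fc fnc xs ls δ α η ε) ((1 - η * α * ε) ^ 2)
    + α * (1 - η * α * ε) * (Real.sqrt η * δ * Mnc S fnc xs δ / 2)
    + α ^ 2 * (2 * (⨆ p : {q : ℝ × E n // q.1 ∈ Icc 0 S ∧ ‖q.2‖ ≤ δ},
          ‖(η * ε) • (1 : E n →L[ℝ] E n) - HbarL c fnc xs ls p.1.2 p.1.1‖)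
            * Dconst S fc fnc xs ls δ η
        + Dconst S fc fnc xs ls δ η ^ 2))

/-- The constant `κ(δ,α,η,ε)`. -/
def kappa (S : ℝ) (c : E n → ℝ → ℝ) (fc fnc : E n → ℝ → E m) (xs : ℝ → E n) (ls : ℝ → E m)
    (δ α η ε : ℝ) : ℝ :=
  max 1 (max ((1 - η * α * ε) / rho S c fc fnc xs ls δ α η ε)
    (Real.sqrt η * α * Lf S (fun x t => fc x t + fnc x t) xs δ
      / rho S c fc fnc xs ls δ α η ε))

/-- Smallest eigenvalue of a symmetric operator, `inf_{‖h‖=1} ⟪A h, h⟫`. -/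
def lambdaMin {d : ℕ} (A : E d →L[ℝ] E d) : ℝ :=
  ⨅ h : {h : E d // ‖h‖ = 1}, ⟪A h.1, h.1⟫

/-- `Λ_m(δ)`. -/
def LambdaM (S : ℝ) (c : E n → ℝ → ℝ) (fc fnc : E n → ℝ → E m) (xs : ℝ → E n)
    (ls : ℝ → E m) (δ : ℝ) : ℝ :=
  ⨅ p : {q : ℝ × E n // q.1 ∈ Icc 0 S ∧ ‖q.2‖ ≤ δ},
    lambdaMin (HbarL c fnc xs ls p.1.2 p.1.1
      + (2⁻¹ : ℝ) • ∑ i, ls p.1.1 i • Hbarfc fc xs i p.1.2 p.1.1)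

/-- `γ(δ,η,ε) = min{Λ_m(δ), ηε} − (√η/4) δ M_nc(δ)`. -/
def gammaC (S : ℝ) (c : E n → ℝ → ℝ) (fc fnc : E n → ℝ → E m) (xs : ℝ → E n)
    (ls : ℝ → E m) (δ η ε : ℝ) : ℝ :=
  min (LambdaM S c fc fnc xs ls δ) (η * ε) - Real.sqrt η / 4 * δ * Mnc S fnc xs δ

/-- The standing data and assumptions of the time-varying nonconvex problem. -/
structure Problem (n m : ℕ) where
  S : ℝ
  hS : 0 < S
  X : ℝ → Set (E n)
  c : E n → ℝ → ℝ
  fc : E n → ℝ → E m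
  fnc : E n → ℝ → E m
  hXne : ∀ t ∈ Icc 0 S, (X t).Nonempty
  hXcl : ∀ t ∈ Icc 0 S, IsClosed (X t)
  hXcv : ∀ t ∈ Icc 0 S, Convex ℝ (X t)
  hc : ∀ t ∈ Icc 0 S, ContDiff ℝ 2 fun x => c x t
  hfc : ∀ t ∈ Icc 0 S, ContDiff ℝ 2 fun x => fc x t
  hfnc : ∀ t ∈ Icc 0 S, ContDiff ℝ 2 fun x => fnc x t
  hcHess : ContinuousOn (fun p : E n × ℝ => fderiv ℝ (fderiv ℝ fun x => c x p.2) p.1)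
    (univ ×ˢ Icc 0 S)
  hfcHess : ∀ i : Fin m, ContinuousOn
    (fun p : E n × ℝ => fderiv ℝ (fderiv ℝ fun x => fc x p.2 i) p.1) (univ ×ˢ Icc 0 S)
  hfncHess : ∀ i : Fin m, ContinuousOn
    (fun p : E n × ℝ => fderiv ℝ (fderiv ℝ fun x => fnc x p.2 i) p.1) (univ ×ˢ Icc 0 S)
  hconv : ∀ t ∈ Icc 0 S, ∀ i : Fin m, ConvexOn ℝ univ fun x => fc x t i

/-- The full constraint function `f = f^c + f^nc`. -/
def Problem.f (P : Problem n m) : E n → ℝ → E m := fun x t => P.fc x t + P.fnc x t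

/-- The KKT conditions at time `t`. -/
def IsKKT (P : Problem n m) (t : ℝ) (x : E n) (lam : E m) : Prop :=
  x ∈ P.X t ∧ lam ∈ orthant m ∧
    -(gradient (fun y => P.c y t) x
        + ContinuousLinearMap.adjoint (fderiv ℝ (fun y => P.f y t) x) lam)
      ∈ normalCone (P.X t) x ∧
    P.f x t ∈ normalCone (orthant m) lam

/-- A Lipschitz trajectory with values in `𝒳(t) × ℝ^m_+`. -/
def IsTraj (P : Problem n m) (xs : ℝ → E n) (ls : ℝ → E m) : Prop :=
  (∃ L : NNReal, LipschitzOnWith L (fun t => (xs t, ls t)) (Icc 0 P.S)) ∧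
    ∀ t ∈ Icc 0 P.S, xs t ∈ P.X t ∧ ls t ∈ orthant m

/-- A Lipschitz KKT trajectory. -/
def IsKKTTraj (P : Problem n m) (xs : ℝ → E n) (ls : ℝ → E m) : Prop :=
  IsTraj P xs ls ∧ ∀ t ∈ Icc 0 P.S, IsKKT P t (xs t) (ls t)

/-- One step of the regularized primal-dual gradient method at time `t`,
from `zp` to `zn`. -/
def IsRPDStep (P : Problem n m) (lamprior : E m) (α η ε t : ℝ)
    (zp zn : E n × E m) : Prop :=
  IsProjection (P.X t)
    (zp.1 - α • (gradient (fun x => P.c x t) zp.1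
      + ContinuousLinearMap.adjoint (fderiv ℝ (fun x => P.f x t) zp.1) zp.2)) zn.1 ∧
  IsProjection (orthant m)
    (zp.2 + (η * α) • (P.f zp.1 t - ε • (zp.2 - lamprior))) zn.2

/-- A Lipschitz solution of the regularized primal-dual gradient flow. -/
def IsFlowSol (P : Problem n m) (lamprior : E m) (β η ε : ℝ)
    (z : ℝ → E n × E m) : Prop :=
  (∃ L : NNReal, LipschitzOnWith L z (Icc 0 P.S)) ∧
  (∀ t ∈ Icc 0 P.S, (z t).1 ∈ P.X t ∧ (z t).2 ∈ orthant m) ∧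
  ∀ᵐ t ∂(volume.restrict (Icc 0 P.S)), ∃ dz : E n × E m, HasDerivAt z dz t ∧
    (-dz.1 - β • (gradient (fun x => P.c x t) (z t).1
        + ContinuousLinearMap.adjoint (fderiv ℝ (fun x => P.f x t) (z t).1) (z t).2)
      ∈ normalCone (P.X t) (z t).1) ∧
    (-dz.2 + (η * β) • (P.f (z t).1 t - ε • ((z t).2 - lamprior))
      ∈ normalCone (orthant m) (z t).2)

section Line

variable {V F : Type*} [NormedAddCommGroup V] [NormedSpace ℝ V]
  [NormedAddCommGroup F] [NormedSpace ℝ F]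

lemma differentiable_fderiv_of_contDiff_two {g : V → F} (hg : ContDiff ℝ 2 g) :
    Differentiable ℝ (fderiv ℝ g) :=
  (hg.fderiv_right (m := 1) (by norm_num)).differentiable (by norm_num)

lemma continuous_fderiv_fderiv_of_contDiff_two {g : V → F} (hg : ContDiff ℝ 2 g) :
    Continuous (fderiv ℝ (fderiv ℝ g)) :=
  (hg.fderiv_right (m := 1) (by norm_num)).continuous_fderiv (by norm_num)

lemma hasDerivAt_line (x u : V) (θ : ℝ) : HasDerivAt (fun s : ℝ => x + s • u) u θ := by
  simpa using ((hasDerivAt_id θ).smul_const u).const_add x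

lemma hasDerivAt_comp_line {g : V → F} (hg : Differentiable ℝ g) (x u : V) (θ : ℝ) :
    HasDerivAt (fun s : ℝ => g (x + s • u)) (fderiv ℝ g (x + θ • u) u) θ :=
  (hg (x + θ • u)).hasFDerivAt.comp_hasDerivAt θ (hasDerivAt_line x u θ)

lemma hasDerivAt_fderiv_comp_line {g : V → F} (hg : ContDiff ℝ 2 g) (x u : V) (θ : ℝ) :
    HasDerivAt (fun s : ℝ => fderiv ℝ g (x + s • u) u)
      (fderiv ℝ (fderiv ℝ g) (x + θ • u) u u) θ :=
  ((ContinuousLinearMap.apply ℝ F u).hasFDerivAt).comp_hasDerivAt θ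
    (hasDerivAt_comp_line (differentiable_fderiv_of_contDiff_two hg) x u θ)

/-- Taylor estimate for the remainder of `g` expanded at the endpoint `x + u`. -/
lemma norm_fderiv_apply_sub_le {g : V → F} (hg : ContDiff ℝ 2 g) (x u : V) {M : ℝ}
    (hM : ∀ θ ∈ Icc (0 : ℝ) 1, ‖fderiv ℝ (fderiv ℝ g) (x + θ • u)‖ ≤ M) :
    ‖fderiv ℝ g (x + u) u - (g (x + u) - g x)‖ ≤ M / 2 * ‖u‖ ^ 2 := by
  have hd : ∀ θ : ℝ, HasDerivAt
      (fun s : ℝ => s • fderiv ℝ g (x + s • u) u - g (x + s • u) + g x)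
      (θ • fderiv ℝ (fderiv ℝ g) (x + θ • u) u u) θ := by
    intro θ
    have h := (((hasDerivAt_id θ).smul (hasDerivAt_fderiv_comp_line hg x u θ)).sub
      (hasDerivAt_comp_line (hg.differentiable (by norm_num)) x u θ)).add_const (g x)
    simpa using h
  have hB : ∀ θ : ℝ, HasDerivAt (fun s : ℝ => M / 2 * ‖u‖ ^ 2 * s ^ 2)
      (M * ‖u‖ ^ 2 * θ) θ := by
    intro θ
    refine ((hasDerivAt_pow 2 θ).const_mul (M / 2 * ‖u‖ ^ 2)).congr_deriv ?_
    norm_num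
    ring
  have h := image_norm_le_of_norm_deriv_right_le_deriv_boundary (a := (0 : ℝ)) (b := 1)
    (fun θ _ => (hd θ).continuousAt.continuousWithinAt) (fun θ _ => (hd θ).hasDerivWithinAt)
    (B := fun s : ℝ => M / 2 * ‖u‖ ^ 2 * s ^ 2) (by simp) hB
    (fun θ hθ => by
      have h1 := (fderiv ℝ (fderiv ℝ g) (x + θ • u)).le_opNorm₂ u u
      have h2 := hM θ ⟨hθ.1, hθ.2.le⟩
      rw [norm_smul, Real.norm_of_nonneg hθ.1]
      calc θ * ‖fderiv ℝ (fderiv ℝ g) (x + θ • u) u u‖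
          ≤ θ * (M * ‖u‖ * ‖u‖) := by
            refine mul_le_mul_of_nonneg_left (h1.trans ?_) hθ.1
            gcongr
        _ = M * ‖u‖ ^ 2 * θ := by ring)
    (x := (1 : ℝ)) (by simp)
  simpa [sub_sub_eq_add_sub, sub_add_eq_add_sub, sub_sub, add_sub_assoc] using h

/-- First-order characterisation of convexity. -/
lemma _root_.ConvexOn.fderiv_apply_le_sub {g : V → ℝ} (hg : ConvexOn ℝ univ g)
    (hd : Differentiable ℝ g) (x v : V) : fderiv ℝ g x v ≤ g (x + v) - g x := by
  have hline : ConvexOn ℝ univ (fun s : ℝ => g (x + s • v)) := by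
    have h := hg.comp_affineMap (AffineMap.lineMap x (x + v) : ℝ →ᵃ[ℝ] V)
    simpa [Function.comp_def, AffineMap.lineMap_apply, add_comm] using h
  have h := hline.le_slope_of_hasDerivAt (mem_univ 0) (mem_univ 1) one_pos
    (hasDerivAt_comp_line hd x v 0)
  simpa [slope_def_field] using h

end Line

section Hessian

variable {d : ℕ}

/-- The inverse Riesz map on a real Euclidean space, as a linear isometry. -/
def rieszSymm (d : ℕ) : StrongDual ℝ (E d) →ₗᵢ[ℝ] E d where
  toFun := (InnerProductSpace.toDual ℝ (E d)).symm
  map_add' := map_add _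
  map_smul' r y := by simp
  norm_map' := (InnerProductSpace.toDual ℝ (E d)).symm.norm_map

lemma hessOp_eq {g : E d → ℝ} (hg : ContDiff ℝ 2 g) (x : E d) :
    hessOp g x
      = (rieszSymm d).toContinuousLinearMap.comp (fderiv ℝ (fderiv ℝ g) x) :=
  ((rieszSymm d).toContinuousLinearMap.hasFDerivAt.comp x
    (differentiable_fderiv_of_contDiff_two hg x).hasFDerivAt).fderiv

lemma inner_hessOp {g : E d → ℝ} (hg : ContDiff ℝ 2 g) (x u v : E d) :
    ⟪hessOp g x u, v⟫ = fderiv ℝ (fderiv ℝ g) x u v := by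
  rw [hessOp_eq hg]
  exact InnerProductSpace.toDual_symm_apply

lemma norm_hessOp_le {g : E d → ℝ} (hg : ContDiff ℝ 2 g) (x : E d) :
    ‖hessOp g x‖ ≤ ‖fderiv ℝ (fderiv ℝ g) x‖ := by
  rw [hessOp_eq hg]
  refine ContinuousLinearMap.opNorm_le_bound _ (norm_nonneg (fderiv ℝ (fderiv ℝ g) x)) fun v => ?_
  simpa using (fderiv ℝ (fderiv ℝ g) x).le_opNorm v

lemma continuous_hessOp {g : E d → ℝ} (hg : ContDiff ℝ 2 g) : Continuous (hessOp g) := by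
  rw [funext (hessOp_eq hg)]
  exact continuous_const.clm_comp (continuous_fderiv_fderiv_of_contDiff_two hg)

lemma inner_intervalIntegral_apply {A : ℝ → E d →L[ℝ] E d} (hA : Continuous A) (u v : E d) :
    ⟪(∫ θ in (0 : ℝ)..1, A θ) u, v⟫ = ∫ θ in (0 : ℝ)..1, ⟪A θ u, v⟫ := by
  have h := ((innerSL ℝ v).comp
    (ContinuousLinearMap.apply ℝ (E d) u)).intervalIntegral_comp_comm
    (hA.intervalIntegrable (μ := volume) 0 1)
  simpa [real_inner_comm] using h.symm

lemma inner_integral_hessOp {g : E d → ℝ} (hg : ContDiff ℝ 2 g) (x u : E d) :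
    ⟪(∫ θ in (0 : ℝ)..1, hessOp g (x + θ • u)) u, u⟫
      = fderiv ℝ g (x + u) u - fderiv ℝ g x u := by
  have hc : Continuous fun θ : ℝ => hessOp g (x + θ • u) :=
    (continuous_hessOp hg).comp (by fun_prop)
  rw [inner_intervalIntegral_apply hc]
  have h := intervalIntegral.integral_eq_sub_of_hasDerivAt (a := 0) (b := 1)
    (f := fun s : ℝ => fderiv ℝ g (x + s • u) u)
    (f' := fun θ => ⟪hessOp g (x + θ • u) u, u⟫)
    (fun θ _ => by
      rw [inner_hessOp hg]
      exact hasDerivAt_fderiv_comp_line hg x u θ)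
    (Continuous.intervalIntegrable (by fun_prop) _ _)
  simpa using h

lemma inner_integral_weighted_hessOp {g : E d → ℝ} (hg : ContDiff ℝ 2 g) (x u : E d) :
    ⟪(∫ θ in (0 : ℝ)..1, (2 * (1 - θ)) • hessOp g (x + θ • u)) u, u⟫
      = 2 * (g (x + u) - g x - fderiv ℝ g x u) := by
  have hc : Continuous fun θ : ℝ => hessOp g (x + θ • u) :=
    (continuous_hessOp hg).comp (by fun_prop)
  rw [inner_intervalIntegral_apply (by fun_prop)]
  have h := intervalIntegral.integral_eq_sub_of_hasDerivAt (a := 0) (b := 1)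
    (f := fun s : ℝ => 2 * ((1 - s) * fderiv ℝ g (x + s • u) u + g (x + s • u)))
    (f' := fun θ => ⟪((2 * (1 - θ)) • hessOp g (x + θ • u)) u, u⟫)
    (fun θ _ => by
      have h := ((((hasDerivAt_id θ).const_sub 1).mul
        (hasDerivAt_fderiv_comp_line hg x u θ)).add
        (hasDerivAt_comp_line (hg.differentiable (by norm_num)) x u θ)).const_mul 2
      refine h.congr_deriv ?_
      rw [smul_apply, real_inner_smul_left, inner_hessOp hg]
      simp only [id]
      ring)
    (Continuous.intervalIntegrable (by fun_prop) _ _)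
  rw [h]
  simp
  ring

lemma neg_norm_le_lambdaMin (A : E d →L[ℝ] E d) : -‖A‖ ≤ lambdaMin A := by
  refine Real.le_iInf (fun h => ?_) (by simp)
  have h1 := (abs_le.1 (abs_real_inner_le_norm (A h.1) h.1)).1
  have h2 := A.le_opNorm h.1
  rw [h.2, mul_one] at h1 h2
  linarith

lemma lambdaMin_mul_sq_le (A : E d →L[ℝ] E d) (u : E d) :
    lambdaMin A * ‖u‖ ^ 2 ≤ ⟪A u, u⟫ := by
  rcases eq_or_ne u 0 with rfl | hu
  · simp
  have hn : 0 < ‖u‖ := norm_pos_iff.2 hu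
  have hbdd : BddBelow (range fun h : {h : E d // ‖h‖ = 1} => ⟪A h.1, h.1⟫) := by
    refine ⟨-‖A‖, ?_⟩
    rintro _ ⟨h, rfl⟩
    have h1 := (abs_le.1 (abs_real_inner_le_norm (A h.1) h.1)).1
    have h2 := A.le_opNorm h.1
    rw [h.2, mul_one] at h1 h2
    simp only
    linarith
  have h := ciInf_le hbdd ⟨‖u‖⁻¹ • u, by
    rw [norm_smul, norm_inv, norm_norm, inv_mul_cancel₀ hn.ne']⟩
  simp only [map_smul, real_inner_smul_left, real_inner_smul_right] at h
  calc lambdaMin A * ‖u‖ ^ 2 ≤ (‖u‖⁻¹ * (‖u‖⁻¹ * ⟪A u, u⟫)) * ‖u‖ ^ 2 := by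
        gcongr
        exact h
    _ = ⟪A u, u⟫ := by field_simp

end Hessian

section Components

variable {V : Type*} [NormedAddCommGroup V] [NormedSpace ℝ V]

lemma norm_le_sum_norm_apply (v : E m) : ‖v‖ ≤ ∑ i, ‖v i‖ := by
  conv_lhs => rw [← (EuclideanSpace.basisFun (Fin m) ℝ).sum_repr v]
  refine (norm_sum_le _ _).trans (Finset.sum_le_sum fun i _ => ?_)
  rw [norm_smul, OrthonormalBasis.norm_eq_one, mul_one]
  rfl

lemma contDiff_component {g : V → E m} (hg : ContDiff ℝ 2 g) (i : Fin m) :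
    ContDiff ℝ 2 fun x => g x i :=
  (EuclideanSpace.proj i : E m →L[ℝ] ℝ).contDiff.comp hg

lemma fderiv_component {g : V → E m} {x : V} (hg : DifferentiableAt ℝ g x)
    (i : Fin m) (u : V) : fderiv ℝ (fun y => g y i) x u = fderiv ℝ g x u i := by
  have h := ((EuclideanSpace.proj i : E m →L[ℝ] ℝ).hasFDerivAt.comp x hg.hasFDerivAt).fderiv
  exact congrArg (fun T : V →L[ℝ] ℝ => T u) h

lemma fderiv_fderiv_component {g : V → E m} (hg : ContDiff ℝ 2 g) (x u v : V) (i : Fin m) :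
    fderiv ℝ (fderiv ℝ fun y => g y i) x u v = fderiv ℝ (fderiv ℝ g) x u v i := by
  have h1 : (fderiv ℝ fun y => g y i)
      = fun y => (EuclideanSpace.proj i : E m →L[ℝ] ℝ).comp (fderiv ℝ g y) := by
    ext y w
    exact fderiv_component (hg.differentiable (by norm_num) y) i w
  have h2 : HasFDerivAt (fun y => (EuclideanSpace.proj i : E m →L[ℝ] ℝ).comp (fderiv ℝ g y))
      ((ContinuousLinearMap.compL ℝ V (E m) ℝ (EuclideanSpace.proj i)).comp
        (fderiv ℝ (fderiv ℝ g) x)) x :=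
    (ContinuousLinearMap.compL ℝ V (E m) ℝ (EuclideanSpace.proj i)).hasFDerivAt.comp x
      (differentiable_fderiv_of_contDiff_two hg x).hasFDerivAt
  rw [h1, h2.fderiv]
  rfl

lemma norm_fderiv_fderiv_le_sum {g : V → E m} (hg : ContDiff ℝ 2 g) (x : V) :
    ‖fderiv ℝ (fderiv ℝ g) x‖ ≤ ∑ i, ‖fderiv ℝ (fderiv ℝ fun y => g y i) x‖ := by
  refine ContinuousLinearMap.opNorm_le_bound₂ _ (Finset.sum_nonneg fun i _ =>
    norm_nonneg (fderiv ℝ (fderiv ℝ fun y => g y i) x)) fun u v => (norm_le_sum_norm_apply _).trans ?_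
  rw [Finset.sum_mul, Finset.sum_mul]
  refine Finset.sum_le_sum fun i _ => ?_
  rw [← fderiv_fderiv_component hg]
  exact ContinuousLinearMap.le_opNorm₂ _ u v

end Components

section Lagrangian

variable {c : E n → ℝ → ℝ} {fnc : E n → ℝ → E m} {t : ℝ}

lemma contDiff_Lnc (hc : ContDiff ℝ 2 fun x => c x t) (hf : ContDiff ℝ 2 fun x => fnc x t)
    (lam : E m) : ContDiff ℝ 2 fun x => Lnc c fnc x lam t :=
  hc.add (contDiff_const.inner ℝ hf)

lemma fderiv_Lnc (hc : ContDiff ℝ 2 fun x => c x t) (hf : ContDiff ℝ 2 fun x => fnc x t)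
    (lam : E m) (x : E n) : fderiv ℝ (fun x => Lnc c fnc x lam t) x
      = fderiv ℝ (fun x => c x t) x + (innerSL ℝ lam).comp (fderiv ℝ (fun x => fnc x t) x) :=
  ((hc.differentiable (by norm_num) x).hasFDerivAt.add
    ((innerSL ℝ lam).hasFDerivAt.comp x
      (hf.differentiable (by norm_num) x).hasFDerivAt)).fderiv

lemma norm_fderiv_fderiv_Lnc_le (hc : ContDiff ℝ 2 fun x => c x t)
    (hf : ContDiff ℝ 2 fun x => fnc x t) (lam : E m) (x : E n) :
    ‖fderiv ℝ (fderiv ℝ fun x => Lnc c fnc x lam t) x‖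
      ≤ ‖fderiv ℝ (fderiv ℝ fun x => c x t) x‖
        + ‖lam‖ * ‖fderiv ℝ (fderiv ℝ fun x => fnc x t) x‖ := by
  have h : HasFDerivAt (fderiv ℝ fun x => Lnc c fnc x lam t)
      (fderiv ℝ (fderiv ℝ fun x => c x t) x
        + (ContinuousLinearMap.compL ℝ (E n) (E m) ℝ (innerSL ℝ lam)).comp
          (fderiv ℝ (fderiv ℝ fun x => fnc x t) x)) x := by
    rw [funext (fderiv_Lnc hc hf lam)]
    exact (differentiable_fderiv_of_contDiff_two hc x).hasFDerivAt.add
      ((ContinuousLinearMap.compL ℝ (E n) (E m) ℝ (innerSL ℝ lam)).hasFDerivAt.comp x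
        (differentiable_fderiv_of_contDiff_two hf x).hasFDerivAt)
  rw [h.fderiv]
  refine (norm_add_le (fderiv ℝ (fderiv ℝ fun x => c x t) x) _).trans
    (add_le_add_right ?_ _)
  refine ContinuousLinearMap.opNorm_le_bound₂ _ (by positivity) fun u v => ?_
  have h1 : ‖⟪lam, fderiv ℝ (fderiv ℝ fun x => fnc x t) x u v⟫‖
      ≤ ‖lam‖ * ‖fderiv ℝ (fderiv ℝ fun x => fnc x t) x u v‖ := norm_inner_le_norm _ _
  have h2 := (fderiv ℝ (fderiv ℝ fun x => fnc x t) x).le_opNorm₂ u v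
  calc _ ≤ ‖lam‖ * ‖fderiv ℝ (fderiv ℝ fun x => fnc x t) x u v‖ := h1
    _ ≤ ‖lam‖ * (‖fderiv ℝ (fderiv ℝ fun x => fnc x t) x‖ * ‖u‖ * ‖v‖) := by gcongr
    _ = _ := by ring

end Lagrangian

section Bounds

variable {F : Type*} [NormedAddCommGroup F] {S : ℝ} {xs : ℝ → E n}

/-- A jointly continuous map is bounded on a tube around a continuous curve. -/
lemma exists_norm_le_on_tube {Φ : E n × ℝ → F} (hΦ : ContinuousOn Φ (univ ×ˢ Icc 0 S))
    (hxs : ContinuousOn xs (Icc 0 S)) (δ : ℝ) :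
    ∃ C, 0 ≤ C ∧ ∀ t ∈ Icc 0 S, ∀ u : E n, ‖u‖ ≤ δ → ‖Φ (xs t + u, t)‖ ≤ C := by
  have hK : IsCompact (Icc (0 : ℝ) S ×ˢ closedBall (0 : E n) δ) :=
    isCompact_Icc.prod (isCompact_closedBall _ _)
  have hcont : ContinuousOn (fun p : ℝ × E n => Φ (xs p.1 + p.2, p.1))
      (Icc (0 : ℝ) S ×ˢ closedBall (0 : E n) δ) := by
    refine hΦ.comp (t := univ ×ˢ Icc 0 S) ?_ fun p hp => ⟨mem_univ _, hp.1⟩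
    exact ((hxs.comp continuousOn_fst fun p hp => hp.1).add continuousOn_snd).prodMk
      continuousOn_fst
  obtain ⟨C, hC⟩ := hK.exists_bound_of_continuousOn hcont
  refine ⟨max C 0, le_max_right _ _, fun t ht u hu => ?_⟩
  exact (hC (t, u) ⟨ht, by simpa using hu⟩).trans (le_max_left _ _)

lemma exists_norm_fderiv_fderiv_le_on_tube {g : E n → ℝ → E m}
    (hg : ∀ t ∈ Icc 0 S, ContDiff ℝ 2 fun x => g x t)
    (hH : ∀ i : Fin m, ContinuousOn
      (fun p : E n × ℝ => fderiv ℝ (fderiv ℝ fun x => g x p.2 i) p.1) (univ ×ˢ Icc 0 S))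
    (hxs : ContinuousOn xs (Icc 0 S)) (δ : ℝ) :
    ∃ C, 0 ≤ C ∧ ∀ t ∈ Icc 0 S, ∀ u : E n, ‖u‖ ≤ δ →
      ‖fderiv ℝ (fderiv ℝ fun x => g x t) (xs t + u)‖ ≤ C := by
  choose C hC0 hC using fun i => exists_norm_le_on_tube
    (F := E n →L[ℝ] E n →L[ℝ] ℝ) (hH i) hxs δ
  exact ⟨∑ i, C i, Finset.sum_nonneg fun i _ => hC0 i, fun t ht u hu =>
    (norm_fderiv_fderiv_le_sum (hg t ht) _).trans
      (Finset.sum_le_sum fun i _ => hC i t ht u hu)⟩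

lemma norm_smul_le_of_mem_Icc {θ δ : ℝ} (hθ : θ ∈ Icc (0 : ℝ) 1) {u : E n} (hu : ‖u‖ ≤ δ) :
    ‖θ • u‖ ≤ δ := by
  rw [norm_smul, Real.norm_of_nonneg hθ.1]
  exact (mul_le_of_le_one_left (norm_nonneg _) hθ.2).trans hu

end Bounds

section Trajectory

variable {P : Problem n m} {xs : ℝ → E n} {ls : ℝ → E m}

lemma IsTraj.continuousOn_fst (h : IsTraj P xs ls) : ContinuousOn xs (Icc 0 P.S) := by
  obtain ⟨⟨L, hL⟩, -⟩ := h
  exact continuous_fst.comp_continuousOn hL.continuousOn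

lemma IsTraj.continuousOn_snd (h : IsTraj P xs ls) : ContinuousOn ls (Icc 0 P.S) := by
  obtain ⟨⟨L, hL⟩, -⟩ := h
  exact continuous_snd.comp_continuousOn hL.continuousOn

lemma norm_fderiv_fderiv_le_Mnc (h : IsTraj P xs ls) {δ t : ℝ} (ht : t ∈ Icc 0 P.S)
    {u : E n} (hu : ‖u‖ ≤ δ) :
    ‖fderiv ℝ (fderiv ℝ fun x => P.fnc x t) (xs t + u)‖ ≤ Mnc P.S P.fnc xs δ := by
  obtain ⟨C, -, hC⟩ :=
    exists_norm_fderiv_fderiv_le_on_tube P.hfnc P.hfncHess h.continuousOn_fst δ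
  refine le_ciSup (f := fun p : {q : ℝ × E n // q.1 ∈ Icc 0 P.S ∧ ‖q.2‖ ≤ δ} =>
    ‖fderiv ℝ (fderiv ℝ (fun x => P.fnc x p.1.1)) (xs p.1.1 + p.1.2)‖) ⟨C, ?_⟩
    ⟨(t, u), ht, hu⟩
  rintro _ ⟨p, rfl⟩
  exact hC _ p.2.1 _ p.2.2

lemma exists_norm_HbarL_le (h : IsTraj P xs ls) (δ : ℝ) :
    ∃ C, ∀ t ∈ Icc 0 P.S, ∀ u : E n, ‖u‖ ≤ δ → ‖HbarL P.c P.fnc xs ls u t‖ ≤ C := by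
  obtain ⟨B, hB⟩ := isCompact_Icc.exists_bound_of_continuousOn h.continuousOn_snd
  obtain ⟨C₁, -, hC₁⟩ := exists_norm_le_on_tube (F := E n →L[ℝ] E n →L[ℝ] ℝ)
    P.hcHess h.continuousOn_fst δ
  obtain ⟨C₂, hC₂0, hC₂⟩ :=
    exists_norm_fderiv_fderiv_le_on_tube P.hfnc P.hfncHess h.continuousOn_fst δ
  refine ⟨C₁ + B * C₂, fun t ht u hu => ?_⟩
  have hint := intervalIntegral.norm_integral_le_of_norm_le_const (a := 0) (b := 1)
    (f := fun θ : ℝ => hessOp (fun x => Lnc P.c P.fnc x (ls t) t) (xs t + θ • u))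
    (C := C₁ + B * C₂) fun θ hθ => by
      rw [uIoc_of_le zero_le_one] at hθ
      have hu' := norm_smul_le_of_mem_Icc ⟨hθ.1.le, hθ.2⟩ hu
      refine (norm_hessOp_le (contDiff_Lnc (P.hc t ht) (P.hfnc t ht) _) _).trans
        ((norm_fderiv_fderiv_Lnc_le (P.hc t ht) (P.hfnc t ht) _ _).trans ?_)
      exact add_le_add (hC₁ t ht _ hu') (mul_le_mul (hB t ht) (hC₂ t ht _ hu')
        (norm_nonneg (fderiv ℝ (fderiv ℝ fun x => P.fnc x t) (xs t + θ • u)))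
        ((norm_nonneg _).trans (hB t ht)))
  simpa [HbarL] using hint

lemma exists_norm_Hbarfc_le (h : IsTraj P xs ls) (δ : ℝ) (i : Fin m) :
    ∃ C, ∀ t ∈ Icc 0 P.S, ∀ u : E n, ‖u‖ ≤ δ → ‖Hbarfc P.fc xs i u t‖ ≤ C := by
  obtain ⟨C, hC0, hC⟩ := exists_norm_le_on_tube (F := E n →L[ℝ] E n →L[ℝ] ℝ)
    (P.hfcHess i) h.continuousOn_fst δ
  refine ⟨2 * C, fun t ht u hu => ?_⟩
  have hint := intervalIntegral.norm_integral_le_of_norm_le_const (a := 0) (b := 1)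
    (f := fun θ : ℝ => (2 * (1 - θ)) • hessOp (fun x => P.fc x t i) (xs t + θ • u))
    (C := 2 * C) fun θ hθ => by
      rw [uIoc_of_le zero_le_one] at hθ
      have hu' := norm_smul_le_of_mem_Icc ⟨hθ.1.le, hθ.2⟩ hu
      rw [norm_smul, Real.norm_of_nonneg (by linarith [hθ.2])]
      exact mul_le_mul (by linarith [hθ.1])
        ((norm_hessOp_le (contDiff_component (P.hfc t ht) i) _).trans (hC t ht _ hu'))
        (norm_nonneg _) (by norm_num)
  simpa [Hbarfc] using hint

lemma LambdaM_le_lambdaMin (h : IsTraj P xs ls) {δ t : ℝ} (ht : t ∈ Icc 0 P.S)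
    {u : E n} (hu : ‖u‖ ≤ δ) :
    LambdaM P.S P.c P.fc P.fnc xs ls δ ≤ lambdaMin (HbarL P.c P.fnc xs ls u t
      + (2⁻¹ : ℝ) • ∑ i, ls t i • Hbarfc P.fc xs i u t) := by
  obtain ⟨B, hB⟩ := isCompact_Icc.exists_bound_of_continuousOn h.continuousOn_snd
  obtain ⟨C, hC⟩ := exists_norm_HbarL_le h δ
  choose D hD using exists_norm_Hbarfc_le h δ
  refine ciInf_le (f := fun p : {q : ℝ × E n // q.1 ∈ Icc 0 P.S ∧ ‖q.2‖ ≤ δ} =>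
    lambdaMin (HbarL P.c P.fnc xs ls p.1.2 p.1.1
      + (2⁻¹ : ℝ) • ∑ i, ls p.1.1 i • Hbarfc P.fc xs i p.1.2 p.1.1))
    ⟨-(C + 2⁻¹ * ∑ i, B * D i), ?_⟩ ⟨(t, u), ht, hu⟩
  rintro _ ⟨⟨⟨s, v⟩, hs, hv⟩, rfl⟩
  refine le_trans (neg_le_neg ?_) (neg_norm_le_lambdaMin _)
  refine (norm_add_le _ _).trans (add_le_add (hC s hs v hv) ?_)
  rw [norm_smul, Real.norm_of_nonneg (by norm_num)]
  refine mul_le_mul_of_nonneg_left ((norm_sum_le _ _).trans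
    (Finset.sum_le_sum fun i _ => ?_)) (by norm_num)
  rw [norm_smul]
  have hBs := hB s hs
  exact mul_le_mul ((PiLp.norm_apply_le (ls s) i).trans hBs) (hD i s hs v hv)
    (norm_nonneg _) ((norm_nonneg _).trans hBs)

end Trajectory

lemma norm_le_of_etaNorm_le {η δ : ℝ} (hη : 0 < η) (hδ : 0 ≤ δ) {z : E n × E m}
    (h : etaNorm η z ≤ δ) : ‖z.1‖ ≤ δ ∧ ‖z.2‖ ≤ Real.sqrt η * δ := by
  rw [etaNorm, Real.sqrt_le_left hδ] at h
  have h2 : 0 ≤ η⁻¹ * ‖z.2‖ ^ 2 := by positivity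
  refine ⟨abs_le_of_sq_le_sq' (by nlinarith [sq_nonneg ‖z.1‖]) hδ |>.2, ?_⟩
  refine (abs_le_of_sq_le_sq' ?_ (by positivity)).2
  rw [mul_pow, Real.sq_sqrt hη.le]
  have h3 : η⁻¹ * ‖z.2‖ ^ 2 ≤ δ ^ 2 := by nlinarith [sq_nonneg ‖z.1‖]
  rwa [inv_mul_le_iff₀ hη] at h3

lemma inner_mono_of_mem_orthant {lam v w : E m} (hl : lam ∈ orthant m) (h : ∀ i, v i ≤ w i) :
    ⟪lam, v⟫ ≤ ⟪lam, w⟫ := by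
  simp only [PiLp.inner_apply]
  refine Finset.sum_le_sum fun i _ => ?_
  simpa [mul_comm] using mul_le_mul_of_nonneg_left (h i) (hl i)

/-- Summing the KKT inequalities at two KKT points of the same time. -/
lemma IsKKT.monotone {P : Problem n m} {t : ℝ} {x y : E n} {lam mu : E m}
    (hx : IsKKT P t x lam) (hy : IsKKT P t y mu) :
    fderiv ℝ (fun z => P.c z t) x (x - y) - fderiv ℝ (fun z => P.c z t) y (x - y)
      + ⟪lam, fderiv ℝ (fun z => P.f z t) x (x - y)⟫
      - ⟪mu, fderiv ℝ (fun z => P.f z t) y (x - y)⟫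
      - ⟪lam - mu, P.f x t - P.f y t⟫ ≤ 0 := by
  have h1 := hx.2.2.1 y hy.1
  have h2 := hy.2.2.1 x hx.1
  have h3 := hx.2.2.2 mu hy.2.1
  have h4 := hy.2.2.2 lam hx.2.1
  have hg : ∀ z v : E n, ⟪gradient (fun y => P.c y t) z, v⟫ = fderiv ℝ (fun y => P.c y t) z v :=
    fun z v => InnerProductSpace.toDual_symm_apply
  rw [← neg_sub x y, inner_neg_right, inner_neg_left, neg_neg, inner_add_left, hg,
    ContinuousLinearMap.adjoint_inner_left] at h1
  rw [inner_neg_left, inner_add_left, hg, ContinuousLinearMap.adjoint_inner_left] at h2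
  rw [real_inner_comm, ← neg_sub lam mu, inner_neg_left] at h3
  rw [real_inner_comm] at h4
  rw [inner_sub_right]
  linarith

/-- **isolation of the KKT trajectory.** If
`Λ_m(δ) − (√η/2) δ M_nc(δ) > 0` for some `δ, η > 0`, then for every `t ∈ [0,S]` there
is no KKT point `z = (x,λ)` at time `t` with `0 < ‖z − z*(t)‖_η ≤ δ` and `x ≠ x*(t)`. -/
theorem isolation_of_KKT {n m : ℕ} (P : Problem n m)
    (xs : ℝ → E n) (ls : ℝ → E m) (hKKT : IsKKTTraj P xs ls)
    (δ η : ℝ) (hδ : 0 < δ) (hη : 0 < η)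
    (hgap : Real.sqrt η / 2 * δ * Mnc P.S P.fnc xs δ
      < LambdaM P.S P.c P.fc P.fnc xs ls δ) :
    ∀ t ∈ Icc (0:ℝ) P.S,
      ¬ ∃ (x : E n) (lam : E m), IsKKT P t x lam ∧
        0 < etaNorm η ((x, lam) - (xs t, ls t)) ∧
        etaNorm η ((x, lam) - (xs t, ls t)) ≤ δ ∧ x ≠ xs t := by
  rintro t ht ⟨x, lam, hx, -, hle, hne⟩
  obtain ⟨htraj, hKKT⟩ := hKKT
  have hmono := hx.monotone (hKKT t ht)
  obtain ⟨hu, hw⟩ := norm_le_of_etaNorm_le hη hδ.le hle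
  simp only [Prod.fst_sub, Prod.snd_sub] at hu hw
  have hxu : x = xs t + (x - xs t) := by abel
  set u := x - xs t with hu_def
  have hu0 : 0 < ‖u‖ := norm_pos_iff.2 (sub_ne_zero.2 hne)
  have hc := P.hc t ht
  have hfc := P.hfc t ht
  have hfnc := P.hfnc t ht
  have hfcd : Differentiable ℝ fun x => P.fc x t := hfc.differentiable (by norm_num)
  have hfncd : Differentiable ℝ fun x => P.fnc x t := hfnc.differentiable (by norm_num)
  set M := Mnc P.S P.fnc xs δ
  have hDf : ∀ y, fderiv ℝ (fun z => P.f z t) y u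
      = fderiv ℝ (fun z => P.fc z t) y u + fderiv ℝ (fun z => P.fnc z t) y u := fun y =>
    congrArg (fun T : E n →L[ℝ] E m => T u)
      ((hfcd y).hasFDerivAt.add (hfncd y).hasFDerivAt).fderiv
  -- the quadratic form of the averaged Hessians
  have hquad := (mul_le_mul_of_nonneg_right (LambdaM_le_lambdaMin htraj ht hu)
    (sq_nonneg ‖u‖)).trans (lambdaMin_mul_sq_le _ u)
  have hHL : ⟪HbarL P.c P.fnc xs ls u t u, u⟫
      = fderiv ℝ (fun z => P.c z t) x u - fderiv ℝ (fun z => P.c z t) (xs t) u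
        + ⟪ls t, fderiv ℝ (fun z => P.fnc z t) x u⟫
        - ⟪ls t, fderiv ℝ (fun z => P.fnc z t) (xs t) u⟫ := by
    rw [HbarL, inner_integral_hessOp (contDiff_Lnc hc hfnc _), ← hxu, fderiv_Lnc hc hfnc,
      fderiv_Lnc hc hfnc]
    simp only [add_apply, ContinuousLinearMap.comp_apply, innerSL_apply_apply]
    ring
  have hHc : ⟪((2⁻¹ : ℝ) • ∑ i, ls t i • Hbarfc P.fc xs i u t) u, u⟫
      = ⟪ls t, P.fc x t - P.fc (xs t) t - fderiv ℝ (fun z => P.fc z t) (xs t) u⟫ := by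
    rw [smul_apply, sum_apply, real_inner_smul_left, sum_inner, Finset.mul_sum,
      PiLp.inner_apply]
    refine Finset.sum_congr rfl fun i _ => ?_
    rw [smul_apply, real_inner_smul_left, Hbarfc, inner_integral_weighted_hessOp (contDiff_component hfc i), ← hxu,
      fderiv_component (hfcd _)]
    simp
    ring
  -- convexity of `f^c`, expanded at `x`
  have hconv : ⟪lam, P.fc x t - P.fc (xs t) t⟫ ≤ ⟪lam, fderiv ℝ (fun z => P.fc z t) x u⟫ := by
    refine inner_mono_of_mem_orthant hx.2.1 fun i => ?_
    have h := (P.hconv t ht i).fderiv_apply_le_sub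
      ((contDiff_component hfc i).differentiable (by norm_num)) x (-u)
    rw [map_neg, fderiv_component (hfcd _), hu_def, ← sub_eq_add_neg, sub_sub_cancel] at h
    simp only [PiLp.sub_apply]
    linarith
  -- the nonconvex remainder
  have hrem : -(M / 2 * ‖u‖ ^ 2 * (Real.sqrt η * δ))
      ≤ ⟪lam - ls t, fderiv ℝ (fun z => P.fnc z t) x u - (P.fnc x t - P.fnc (xs t) t)⟫ := by
    have h := norm_fderiv_apply_sub_le hfnc (xs t) u (M := M) fun θ hθ =>
      norm_fderiv_fderiv_le_Mnc htraj ht (norm_smul_le_of_mem_Icc hθ hu)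
    rw [← hxu] at h
    refine le_trans (neg_le_neg ?_) (abs_le.1 (abs_real_inner_le_norm _ _)).1
    rw [mul_comm]
    exact mul_le_mul h hw (norm_nonneg _) ((norm_nonneg _).trans h)
  have hstrict := mul_lt_mul_of_pos_right hgap (pow_pos hu0 2)
  rw [add_apply, inner_add_left, hHL, hHc] at hquad
  rw [hDf, hDf] at hmono
  simp only [Problem.f, inner_add_right, inner_sub_left, inner_sub_right]
    at hmono hquad hconv hrem
  linarith

end TVOpt
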